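/- arXiv:1102.1510 — 9 statements merged into one kernel-verified Lean document; each statement's English description precedes it below -/
import Mathlib

section
/- Define T : [0,3] → [0,3] by T(x) = 0 for x ≠ 3 and T(3) = 1. Then T satisfies condition (C), but T is not continuous (hence not nonexpansive). -/
/-- The map `T` on `[0,3]` with `T x = 0` for `x ≠ 3` and `T 3 = 1`
satisfies condition (C), but is not continuous on `[0,3]`
(and hence is not nonexpansive). -/
theorem suzuki_example_condition_C :
    ∀ T : ℝ → ℝ, (∀ x, T x = if x = 3 then 1 else 0) →
    (∀ x ∈ Set.Icc (0:ℝ) 3, ∀ y ∈ Set.Icc (0:ℝ) 3,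
        (1/2) * ‖x - T x‖ ≤ ‖x - y‖ → ‖T x - T y‖ ≤ ‖x - y‖) ∧
    ¬ ContinuousOn T (Set.Icc (0:ℝ) 3) ∧
    ¬ (∀ x ∈ Set.Icc (0:ℝ) 3, ∀ y ∈ Set.Icc (0:ℝ) 3, ‖T x - T y‖ ≤ ‖x - y‖) := by
  intro T hT
  have hT3 : T 3 = 1 := by simp [hT]
  have hT0 : ∀ x, x ≠ 3 → T x = 0 := fun x hx => by simp [hT, hx]
  refine ⟨fun x hx y hy h => ?_, fun hcont => ?_, fun hne => ?_⟩
  · obtain ⟨hx0, hx3⟩ := hx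
    obtain ⟨hy0, hy3⟩ := hy
    simp only [Real.norm_eq_abs] at h ⊢
    by_cases hx : x = 3 <;> by_cases hy : y = 3
    · simp [hx, hy]
    · subst hx
      rw [hT3, abs_of_nonneg (by norm_num),
        abs_of_nonneg (by linarith)] at h
      rw [hT3, hT0 y hy, sub_zero, abs_one]
      exact (by linarith : (1 : ℝ) ≤ 3 - y).trans (le_abs_self _)
    · subst hy
      rw [hT0 x hx, abs_of_nonneg (by linarith),
        abs_of_nonpos (by linarith)] at h
      rw [hT0 x hx, hT3, zero_sub, abs_neg, abs_one, abs_of_nonpos (by linarith)]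
      linarith
    · simp [hT0 x hx, hT0 y hy]
  · obtain ⟨δ, hδ, h⟩ := Metric.continuousOn_iff.mp hcont 3 (by norm_num) 1 one_pos
    have hm : 0 < min (δ / 2) 3 := lt_min (by linarith) (by norm_num)
    have hmδ : min (δ / 2) 3 < δ := (min_le_left _ _).trans_lt (by linarith)
    have hm3 : min (δ / 2) 3 ≤ 3 := min_le_right _ _
    have hd := h (3 - min (δ / 2) 3) ⟨by linarith, by linarith⟩
      (by rw [Real.dist_eq, abs_lt]; constructor <;> linarith)
    rw [hT3, hT0 _ (by intro h3; linarith)] at hd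
    norm_num at hd
  · have h := hne 3 (by norm_num) (5 / 2) (by norm_num)
    rw [hT3, hT0 _ (by norm_num)] at h
    norm_num at h
end

section
/- Let D be a nonempty bounded convex subset of a Banach space X, and let T : D → D satisfy condition (C_λ) on D for some λ ∈ (0,1). Fix r ∈ [λ, 1) and define a sequence {x_n} in D by choosing x₁ ∈ D and setting x_{n+1} = r T(x_n) + (1 − r) x_n for n ≥ 1. Then lim_{n→∞} ‖x_n − T(x_n)‖ = 0, i.e., {x_n} is an approximate fixed point sequence for T. -/
section KrasnoselskiiIteration

variable {X : Type*} [NormedAddCommGroup X] [NormedSpace ℝ X] {r : ℝ} {x y : ℕ → X}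

lemma norm_succ_sub_of_krasnoselskii (hr0 : 0 < r)
    (hrec : ∀ n, x (n + 1) = r • y n + (1 - r) • x n) (n : ℕ) :
    ‖x (n + 1) - x n‖ = r * ‖y n - x n‖ := by
  rw [show x (n + 1) - x n = r • (y n - x n) by rw [hrec n]; module, norm_smul,
    Real.norm_of_nonneg hr0.le]

lemma antitone_norm_sub_of_krasnoselskii (hr0 : 0 < r) (hr1 : r < 1)
    (hrec : ∀ n, x (n + 1) = r • y n + (1 - r) • x n)
    (hy : ∀ n, ‖y (n + 1) - y n‖ ≤ ‖x (n + 1) - x n‖) :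
    Antitone fun n => ‖y n - x n‖ := by
  refine antitone_nat_of_succ_le fun n => ?_
  have hsplit : y (n + 1) - x (n + 1) = (y (n + 1) - y n) + (1 - r) • (y n - x n) := by
    rw [hrec n]; module
  have hle := norm_add_le (y (n + 1) - y n) ((1 - r) • (y n - x n))
  rw [← hsplit, norm_smul, Real.norm_of_nonneg (sub_nonneg.2 hr1.le)] at hle
  have hstep := hy n
  rw [norm_succ_sub_of_krasnoselskii hr0 hrec n] at hstep
  linarith

lemma norm_add_sub_le_of_krasnoselskii (hr0 : 0 < r) (hr1 : r < 1)
    (hrec : ∀ n, x (n + 1) = r • y n + (1 - r) • x n)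
    (hy : ∀ n, ‖y (n + 1) - y n‖ ≤ ‖x (n + 1) - x n‖) (i n : ℕ) :
    ‖y (i + n) - y i‖ ≤ n * (r * ‖y i - x i‖) := by
  induction n with
  | zero => simp
  | succ n ih =>
    have htri := norm_sub_le_norm_sub_add_norm_sub (y (i + n + 1)) (y (i + n)) (y i)
    have hstep := hy (i + n)
    rw [norm_succ_sub_of_krasnoselskii hr0 hrec] at hstep
    have hanti : ‖y (i + n) - x (i + n)‖ ≤ ‖y i - x i‖ :=
      antitone_norm_sub_of_krasnoselskii hr0 hr1 hrec hy (Nat.le_add_right i n)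
    have hmul := mul_le_mul_of_nonneg_left hanti hr0.le
    rw [← add_assoc]
    push_cast
    linarith

/-- The Goebel–Kirk inequality. -/
lemma goebel_kirk_inequality (hr0 : 0 < r) (hr1 : r < 1)
    (hrec : ∀ n, x (n + 1) = r • y n + (1 - r) • x n)
    (hy : ∀ n, ‖y (n + 1) - y n‖ ≤ ‖x (n + 1) - x n‖) (n i : ℕ) :
    (1 + n * r) * ‖y i - x i‖ ≤
      ‖y (i + n) - x i‖ + ((1 - r)⁻¹) ^ n * (‖y i - x i‖ - ‖y (i + n) - x (i + n)‖) := by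
  have hs : 0 < 1 - r := sub_pos.2 hr1
  induction n generalizing i with
  | zero => simp
  | succ n ih =>
    have hih := ih (i + 1)
    rw [show i + 1 + n = i + (n + 1) by ring] at hih
    have hsplit : y (i + (n + 1)) - x (i + 1) =
        (1 - r) • (y (i + (n + 1)) - x i) + r • (y (i + (n + 1)) - y i) := by
      rw [hrec i]; module
    have htri := norm_add_le ((1 - r) • (y (i + (n + 1)) - x i)) (r • (y (i + (n + 1)) - y i))
    rw [← hsplit, norm_smul, norm_smul, Real.norm_of_nonneg hs.le,
      Real.norm_of_nonneg hr0.le] at htri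
    have hdist := mul_le_mul_of_nonneg_left
      (norm_add_sub_le_of_krasnoselskii hr0 hr1 hrec hy i (n + 1)) hr0.le
    have hanti : ‖y (i + 1) - x (i + 1)‖ ≤ ‖y i - x i‖ :=
      antitone_norm_sub_of_krasnoselskii hr0 hr1 hrec hy (Nat.le_succ i)
    have hinv : 1 + r ≤ (1 - r)⁻¹ := by
      rw [le_inv_comm₀ (by linarith) hs, inv_eq_one_div, le_div_iff₀ (by linarith)]
      nlinarith
    have hbern : 1 + n * r ≤ ((1 - r)⁻¹) ^ n :=
      (one_add_mul_le_pow (by linarith) n).trans (pow_le_pow_left₀ (by linarith) hinv n)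
    have hprod := mul_nonneg (sub_nonneg.2 hbern) (sub_nonneg.2 hanti)
    refine le_of_mul_le_mul_left ?_ hs
    rw [mul_add, pow_succ', ← mul_assoc (1 - r) (_ * _), mul_inv_cancel_left₀ hs.ne']
    push_cast at hdist ⊢
    linarith

theorem tendsto_norm_sub_of_krasnoselskii (hr0 : 0 < r) (hr1 : r < 1)
    (hrec : ∀ n, x (n + 1) = r • y n + (1 - r) • x n)
    (hy : ∀ n, ‖y (n + 1) - y n‖ ≤ ‖x (n + 1) - x n‖)
    {M : ℝ} (hM : ∀ m n, ‖y m - x n‖ ≤ M) :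
    Filter.Tendsto (fun n => ‖y n - x n‖) Filter.atTop (nhds 0) := by
  have hbdd : BddBelow (Set.range fun n => ‖y n - x n‖) :=
    ⟨0, by rintro _ ⟨n, rfl⟩; exact norm_nonneg _⟩
  have hlim := tendsto_atTop_ciInf (antitone_norm_sub_of_krasnoselskii hr0 hr1 hrec hy) hbdd
  set L := ⨅ n, ‖y n - x n‖
  have hL0 : 0 ≤ L := ge_of_tendsto' hlim fun n => norm_nonneg _
  have hLM (n : ℕ) : (1 + n * r) * L ≤ M := by
    have hright := ((hlim.sub (hlim.comp (Filter.tendsto_add_atTop_nat n))).const_mul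
      (((1 - r)⁻¹) ^ n)).const_add M
    rw [sub_self, mul_zero, add_zero] at hright
    exact le_of_tendsto_of_tendsto' (hlim.const_mul _) hright fun i =>
      (goebel_kirk_inequality hr0 hr1 hrec hy n i).trans (by gcongr; exacts [hM _ _, le_rfl])
  rcases hL0.eq_or_lt with hL | hL
  · rwa [← hL] at hlim
  · obtain ⟨n, hn⟩ := exists_nat_gt (M / (r * L))
    rw [div_lt_iff₀ (mul_pos hr0 hL)] at hn
    linarith [hLM n]

end KrasnoselskiiIteration

/-- If `D` is a nonempty bounded convex subset of a Banach space,
`T : D → D` satisfies condition `(C_λ)` for some `λ ∈ (0,1)`, `r ∈ [λ,1)`, and the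
sequence `{x_n} ⊆ D` satisfies `x_{n+1} = r T(x_n) + (1-r) x_n`, then
`‖x_n - T(x_n)‖ → 0`. -/
theorem approximate_fixed_point_sequence {X : Type*} [NormedAddCommGroup X]
    [NormedSpace ℝ X] [CompleteSpace X]
    (D : Set X) (hne : D.Nonempty) (hbdd : Bornology.IsBounded D) (hconv : Convex ℝ D)
    (T : X → X) (hT : Set.MapsTo T D D)
    (l : ℝ) (hl : l ∈ Set.Ioo (0:ℝ) 1)
    (hC : ∀ x ∈ D, ∀ y ∈ D, l * ‖x - T x‖ ≤ ‖x - y‖ → ‖T x - T y‖ ≤ ‖x - y‖)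
    (r : ℝ) (hr : r ∈ Set.Ico l 1)
    (x : ℕ → X) (hx0 : x 0 ∈ D)
    (hrec : ∀ n, x (n + 1) = r • T (x n) + (1 - r) • x n) :
    Filter.Tendsto (fun n => ‖x n - T (x n)‖) Filter.atTop (nhds 0) := by
  have hr0 : 0 < r := hl.1.trans_le hr.1
  have hxD (n : ℕ) : x n ∈ D := by
    induction n with
    | zero => exact hx0
    | succ n ih =>
      rw [hrec n]
      exact hconv (hT ih) ih hr0.le (sub_nonneg.2 hr.2.le) (by ring)
  have hy (n : ℕ) : ‖T (x (n + 1)) - T (x n)‖ ≤ ‖x (n + 1) - x n‖ := by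
    rw [norm_sub_rev, norm_sub_rev (x (n + 1))]
    refine hC _ (hxD n) _ (hxD (n + 1)) ?_
    rw [norm_sub_rev _ (x (n + 1)),
      norm_succ_sub_of_krasnoselskii (y := fun n => T (x n)) hr0 hrec n, norm_sub_rev]
    exact mul_le_mul_of_nonneg_right hr.1 (norm_nonneg _)
  obtain ⟨M, hM⟩ := Metric.isBounded_iff.1 hbdd
  simp_rw [norm_sub_rev (x _)]
  exact tendsto_norm_sub_of_krasnoselskii (y := fun n => T (x n)) hr0 hr.2 hrec hy
    fun m n => by simpa only [dist_eq_norm] using hM (hT (hxD m)) (hxD n)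
end

section
/- Let X be a strictly convex Banach space, D a closed convex subset of X, and T : D → D a single-valued mapping satisfying conditions (E) and (C_λ) for some λ ∈ (0,1). Then the fixed point set Fix(T) = {x ∈ D : Tx = x} is convex. -/
/-- If `X` is a strictly convex Banach space, `D ⊆ X` is closed and convex,
and `T : D → D` satisfies conditions (E) and `(C_λ)` for some `λ ∈ (0,1)`, then `Fix(T)`
is convex. -/
theorem fixed_point_set_convex {X : Type*} [NormedAddCommGroup X] [NormedSpace ℝ X]
    [CompleteSpace X] [StrictConvexSpace ℝ X]
    (D : Set X) (hDcl : IsClosed D) (hDconv : Convex ℝ D)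
    (T : X → X) (hT : Set.MapsTo T D D)
    (l : ℝ) (hl : l ∈ Set.Ioo (0:ℝ) 1)
    (hC : ∀ x ∈ D, ∀ y ∈ D, l * ‖x - T x‖ ≤ ‖x - y‖ → ‖T x - T y‖ ≤ ‖x - y‖)
    (hE : ∃ μ : ℝ, 1 ≤ μ ∧ ∀ x ∈ D, ∀ y ∈ D, ‖x - T y‖ ≤ μ * ‖x - T x‖ + ‖x - y‖) :
    Convex ℝ {x ∈ D | T x = x} := by
  obtain ⟨μ, -, hE⟩ := hE
  rintro x ⟨hxD, hx⟩ y ⟨hyD, hy⟩ a b ha hb hab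
  obtain rfl : a = 1 - b := by linarith
  have hzD := hDconv hxD hyD ha hb hab
  refine ⟨hzD, ?_⟩
  set z := (1 - b) • x + b • y with hz
  have hxz : ‖x - z‖ = b * ‖x - y‖ := by
    rw [show x - z = b • (x - y) by rw [hz]; module, norm_smul, Real.norm_of_nonneg hb]
  have hyz : ‖y - z‖ = (1 - b) * ‖x - y‖ := by
    rw [show y - z = (1 - b) • (y - x) by rw [hz]; module, norm_smul,
      Real.norm_of_nonneg ha, norm_sub_rev y x]
  have hxT : dist x (T z) ≤ b * dist x y := by
    simpa [hx, hxz, dist_eq_norm] using hE x hxD z hzD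
  have hyT : dist (T z) y ≤ (1 - b) * dist x y := by
    simpa [hy, hyz, dist_eq_norm, norm_sub_rev (T z) y] using hE y hyD z hzD
  have htri := dist_triangle x (T z) y
  rw [eq_lineMap_of_dist_eq_mul_of_dist_eq_mul (show dist x (T z) = b * dist x y by linarith)
    (show dist (T z) y = (1 - b) * dist x y by linarith), AffineMap.lineMap_apply_module]
end

section
/- Define the multivalued mapping T on [0,5] by T(x) = [0, x/5] for x ≠ 5 and T(5) = {1}. Then T satisfies condition (C_λ) for some λ ∈ (0,1) and condition (E) for some μ ≥ 1, but T is not a nonexpansive multivalued mapping. -/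
/-- The distance from `x` to `[0, x/5]` is attained at the right endpoint. -/
lemma infDist_Icc_zero_div_five {x : ℝ} (hx : 0 ≤ x) :
    Metric.infDist x (Set.Icc 0 (x / 5)) = 4 * x / 5 := by
  apply le_antisymm
  · refine (Metric.infDist_le_dist_of_mem (Set.right_mem_Icc.2 (by positivity))).trans ?_
    rw [Real.dist_eq, abs_of_nonneg (by linarith)]
    linarith
  · refine (Metric.le_infDist (Set.nonempty_Icc.2 (by positivity))).2 fun z hz => ?_
    rw [Real.dist_eq]
    linarith [le_abs_self (x - z), hz.2]

lemma infDist_Icc_zero_le {x a r : ℝ} (hx : 0 ≤ x) (ha : 0 ≤ a) (hr : 0 ≤ r) (h : x - a ≤ r) :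
    Metric.infDist x (Set.Icc 0 a) ≤ r := by
  have hmem : min x a ∈ Set.Icc 0 a := ⟨le_min hx ha, min_le_right _ _⟩
  refine (Metric.infDist_le_dist_of_mem hmem).trans ?_
  rw [Real.dist_eq, abs_of_nonneg (by linarith [min_le_left x a])]
  rcases min_cases x a with ⟨h', _⟩ | ⟨h', _⟩ <;> rw [h'] <;> linarith

lemma hausdorffDist_Icc_zero_le {a b : ℝ} (ha : 0 ≤ a) (hb : 0 ≤ b) :
    Metric.hausdorffDist (Set.Icc 0 a) (Set.Icc 0 b) ≤ |a - b| := by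
  refine Metric.hausdorffDist_le_of_infDist (abs_nonneg _) (fun z hz => ?_) fun z hz => ?_
  · exact infDist_Icc_zero_le hz.1 hb (abs_nonneg _) (by linarith [hz.2, le_abs_self (a - b)])
  · exact infDist_Icc_zero_le hz.1 ha (abs_nonneg _) (by linarith [hz.2, neg_abs_le (a - b)])

lemma hausdorffDist_Icc_zero_singleton_one_le {a : ℝ} (ha : 0 ≤ a) (ha' : a ≤ 1) :
    Metric.hausdorffDist (Set.Icc 0 a) {1} ≤ 1 := by
  refine Metric.hausdorffDist_le_of_infDist zero_le_one (fun z hz => ?_) fun z hz => ?_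
  · rw [Metric.infDist_singleton, Real.dist_eq, abs_le]
    constructor <;> linarith [hz.1, hz.2]
  · rw [Set.mem_singleton_iff.1 hz]
    exact infDist_Icc_zero_le zero_le_one ha zero_le_one (by linarith)

lemma one_le_hausdorffDist_Icc_zero_singleton_one {a : ℝ} (ha : 0 ≤ a) :
    1 ≤ Metric.hausdorffDist (Set.Icc 0 a) {1} := by
  have h := Metric.infDist_le_hausdorffDist_of_mem (Set.left_mem_Icc.2 ha)
    (Metric.hausdorffEDist_ne_top_of_nonempty_of_bounded (Set.nonempty_Icc.2 ha)
      (Set.singleton_nonempty (1 : ℝ)) (Metric.isBounded_Icc 0 a) Bornology.isBounded_singleton)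
  simpa [Metric.infDist_singleton] using h

/-- The multivalued map `T` on `[0,5]` with `T x = [0, x/5]` for `x ≠ 5`
and `T 5 = {1}` satisfies condition `(C_λ)` for some `λ ∈ (0,1)` and condition (E)
for some `μ ≥ 1`, but is not nonexpansive. -/
theorem multivalued_example :
    ∀ T : ℝ → Set ℝ, (∀ x, T x = if x = 5 then {1} else Set.Icc 0 (x / 5)) →
    (∃ l : ℝ, l ∈ Set.Ioo (0:ℝ) 1 ∧
      ∀ x ∈ Set.Icc (0:ℝ) 5, ∀ y ∈ Set.Icc (0:ℝ) 5,
        l * Metric.infDist x (T x) ≤ ‖x - y‖ →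
          Metric.hausdorffDist (T x) (T y) ≤ ‖x - y‖) ∧
    (∃ μ : ℝ, 1 ≤ μ ∧
      ∀ x ∈ Set.Icc (0:ℝ) 5, ∀ y ∈ Set.Icc (0:ℝ) 5,
        Metric.infDist x (T y) ≤ μ * Metric.infDist x (T x) + ‖x - y‖) ∧
    ¬ (∀ x ∈ Set.Icc (0:ℝ) 5, ∀ y ∈ Set.Icc (0:ℝ) 5,
        Metric.hausdorffDist (T x) (T y) ≤ ‖x - y‖) := by
  intro T hT
  have hT5 : T 5 = {1} := by simp [hT]
  have hTne : ∀ {x : ℝ}, x ≠ 5 → T x = Set.Icc 0 (x / 5) := fun hx => by simp [hT, hx]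
  refine ⟨⟨1 / 2, by norm_num, ?_⟩, ⟨1, le_rfl, ?_⟩, ?_⟩
  · rintro x ⟨hx0, hx5⟩ y ⟨hy0, hy5⟩ h
    rw [Real.norm_eq_abs] at h ⊢
    by_cases hx : x = 5 <;> by_cases hy : y = 5
    · subst hx hy
      simp
    · subst hx
      rw [hT5, Metric.infDist_singleton, Real.dist_eq, abs_of_nonneg (by norm_num)] at h
      rw [hT5, hTne hy, Metric.hausdorffDist_comm]
      refine (hausdorffDist_Icc_zero_singleton_one_le (by positivity) (by linarith)).trans ?_
      linarith
    · subst hy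
      rw [hTne hx, infDist_Icc_zero_div_five hx0] at h
      rw [hT5, hTne hx]
      refine (hausdorffDist_Icc_zero_singleton_one_le (by positivity) (by linarith)).trans ?_
      rw [abs_of_nonpos (by linarith)] at h ⊢
      linarith
    · rw [hTne hx, hTne hy]
      refine (hausdorffDist_Icc_zero_le (by positivity) (by positivity)).trans ?_
      rw [← sub_div, abs_div, abs_of_pos (by norm_num : (0 : ℝ) < 5)]
      linarith [abs_nonneg (x - y)]
  · rintro x ⟨hx0, hx5⟩ y ⟨hy0, hy5⟩
    rw [Real.norm_eq_abs, one_mul]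
    by_cases hy : y = 5
    · subst hy
      by_cases hx : x = 5
      · subst hx
        simp
      · rw [hT5, hTne hx, infDist_Icc_zero_div_five hx0, Metric.infDist_singleton, Real.dist_eq,
          abs_of_nonpos (by linarith : x - 5 ≤ 0), abs_le]
        constructor <;> linarith
    · rw [hTne hy]
      refine infDist_Icc_zero_le hx0 (by positivity)
        (add_nonneg Metric.infDist_nonneg (abs_nonneg _)) ?_
      by_cases hx : x = 5
      · subst hx
        rw [hT5, Metric.infDist_singleton, Real.dist_eq, abs_of_nonneg (by norm_num)]
        linarith [le_abs_self (5 - y)]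
      · rw [hTne hx, infDist_Icc_zero_div_five hx0]
        linarith [le_abs_self (x - y), abs_nonneg (x - y)]
  · intro h
    have h₁ := h (9 / 2) (by norm_num) 5 (by norm_num)
    rw [hT5, hTne (by norm_num), Real.norm_eq_abs, abs_of_nonpos (by norm_num)] at h₁
    have h₂ := one_le_hausdorffDist_Icc_zero_singleton_one (a := 9 / 2 / 5) (by norm_num)
    linarith
end

section
/- Let {z_n} and {w_n} be two bounded sequences in a Banach space X and let 0 < λ < 1. If for every natural number n we have z_{n+1} = λ w_n + (1 − λ) z_n and ‖w_{n+1} − w_n‖ ≤ ‖z_{n+1} − z_n‖, then lim_{n→∞} ‖w_n − z_n‖ = 0. -/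
section GoebelKirk

variable {X : Type*} [NormedAddCommGroup X] [NormedSpace ℝ X] {z w : ℕ → X} {l : ℝ}

lemma norm_succ_sub_of_krasnoselskii_s8 (hl0 : 0 < l)
    (hrec : ∀ n, z (n + 1) = l • w n + (1 - l) • z n) (n : ℕ) :
    ‖z (n + 1) - z n‖ = l * ‖w n - z n‖ := by
  have h : z (n + 1) - z n = l • (w n - z n) := by rw [hrec]; module
  rw [h, norm_smul, Real.norm_of_nonneg hl0.le]

lemma antitone_norm_sub_of_krasnoselskii_s8 (hl0 : 0 < l) (hl1 : l < 1)
    (hrec : ∀ n, z (n + 1) = l • w n + (1 - l) • z n)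
    (hcontr : ∀ n, ‖w (n + 1) - w n‖ ≤ ‖z (n + 1) - z n‖) :
    Antitone fun n => ‖w n - z n‖ := by
  refine antitone_nat_of_succ_le fun n => ?_
  have h : w (n + 1) - z (n + 1) = (w (n + 1) - w n) + (1 - l) • (w n - z n) := by
    rw [hrec]; module
  have h1 := norm_add_le (w (n + 1) - w n) ((1 - l) • (w n - z n))
  rw [← h, norm_smul, Real.norm_of_nonneg (sub_nonneg.2 hl1.le)] at h1
  have h2 := hcontr n
  rw [norm_succ_sub_of_krasnoselskii_s8 hl0 hrec] at h2
  linarith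

lemma norm_add_sub_le_of_krasnoselskii_s8 (hl0 : 0 < l) (hl1 : l < 1)
    (hrec : ∀ n, z (n + 1) = l • w n + (1 - l) • z n)
    (hcontr : ∀ n, ‖w (n + 1) - w n‖ ≤ ‖z (n + 1) - z n‖) (i n : ℕ) :
    ‖w (i + n) - w i‖ ≤ n * (l * ‖w i - z i‖) := by
  induction n with
  | zero => simp
  | succ n ih =>
    have h1 := norm_sub_le_norm_sub_add_norm_sub (w (i + n + 1)) (w (i + n)) (w i)
    have h2 := hcontr (i + n)
    rw [norm_succ_sub_of_krasnoselskii_s8 hl0 hrec] at h2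
    have h3 : ‖w (i + n) - z (i + n)‖ ≤ ‖w i - z i‖ :=
      antitone_norm_sub_of_krasnoselskii_s8 hl0 hl1 hrec hcontr (Nat.le_add_right i n)
    have h4 := mul_le_mul_of_nonneg_left h3 hl0.le
    rw [← add_assoc]
    push_cast
    linarith

/-- A form of the Goebel–Kirk inequality with an unspecified constant in place of `(1 - l)⁻ⁿ`. -/
lemma exists_goebel_kirk_inequality (hl0 : 0 < l) (hl1 : l < 1)
    (hrec : ∀ n, z (n + 1) = l • w n + (1 - l) • z n)
    (hcontr : ∀ n, ‖w (n + 1) - w n‖ ≤ ‖z (n + 1) - z n‖) (n : ℕ) :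
    ∃ C : ℝ, 0 ≤ C ∧ ∀ i, (1 + n * l) * ‖w i - z i‖ ≤
      ‖w (i + n) - z i‖ + C * (‖w i - z i‖ - ‖w (i + n) - z (i + n)‖) := by
  have hl : 0 < 1 - l := sub_pos.2 hl1
  have hanti := antitone_norm_sub_of_krasnoselskii_s8 hl0 hl1 hrec hcontr
  induction n with
  | zero => exact ⟨0, le_rfl, fun i => by simp⟩
  | succ n ih =>
    obtain ⟨C, hC, h⟩ := ih
    refine ⟨(C + (1 + n * l)) / (1 - l), by positivity, fun i => ?_⟩
    have hi := h (i + 1)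
    rw [add_right_comm i 1 n, add_assoc i n 1] at hi
    have heq : w (i + (n + 1)) - z (i + 1) =
        l • (w (i + (n + 1)) - w i) + (1 - l) • (w (i + (n + 1)) - z i) := by
      rw [hrec]; module
    have h1 := norm_add_le (l • (w (i + (n + 1)) - w i)) ((1 - l) • (w (i + (n + 1)) - z i))
    rw [← heq, norm_smul, norm_smul, Real.norm_of_nonneg hl0.le,
      Real.norm_of_nonneg hl.le] at h1
    have h2 := mul_le_mul_of_nonneg_left
      (norm_add_sub_le_of_krasnoselskii_s8 hl0 hl1 hrec hcontr i (n + 1)) hl0.le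
    have h3 : ‖w (i + 1) - z (i + 1)‖ ≤ ‖w i - z i‖ := hanti (Nat.le_add_right i 1)
    have h4 : ‖w (i + (n + 1)) - z (i + (n + 1))‖ ≤ ‖w (i + 1) - z (i + 1)‖ :=
      hanti (by omega)
    have h5 := mul_le_mul_of_nonneg_left h3 hC
    have h6 := mul_le_mul_of_nonneg_left h4 (by positivity : (0 : ℝ) ≤ 1 + n * l)
    refine le_of_mul_le_mul_left ?_ hl
    rw [mul_add, ← mul_assoc (1 - l) (_ / _), mul_div_cancel₀ _ hl.ne']
    push_cast at h2 ⊢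
    linarith

end GoebelKirk


/-- Goebel–Kirk lemma: If `{z_n}` and `{w_n}` are bounded sequences in a
Banach space, `0 < λ < 1`, `z_{n+1} = λ w_n + (1-λ) z_n` and
`‖w_{n+1} - w_n‖ ≤ ‖z_{n+1} - z_n‖` for all `n`, then `‖w_n - z_n‖ → 0`. -/
theorem goebel_kirk_lemma {X : Type*} [NormedAddCommGroup X] [NormedSpace ℝ X]
    [CompleteSpace X]
    (z w : ℕ → X)
    (hz : Bornology.IsBounded (Set.range z)) (hw : Bornology.IsBounded (Set.range w))
    (l : ℝ) (hl0 : 0 < l) (hl1 : l < 1)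
    (hrec : ∀ n, z (n + 1) = l • w n + (1 - l) • z n)
    (hcontr : ∀ n, ‖w (n + 1) - w n‖ ≤ ‖z (n + 1) - z n‖) :
    Filter.Tendsto (fun n => ‖w n - z n‖) Filter.atTop (nhds 0) := by
  have hanti := antitone_norm_sub_of_krasnoselskii_s8 hl0 hl1 hrec hcontr
  obtain ⟨A, hA⟩ := hz.exists_norm_le
  obtain ⟨B, hB⟩ := hw.exists_norm_le
  obtain ⟨r, hr⟩ : ∃ r, Filter.Tendsto (fun n => ‖w n - z n‖) Filter.atTop (nhds r) :=
    ⟨_, tendsto_atTop_ciInf hanti ⟨0, by rintro _ ⟨n, rfl⟩; positivity⟩⟩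
  have hr0 : 0 ≤ r := ge_of_tendsto' hr fun n => norm_nonneg _
  have hbound : ∀ n : ℕ, (1 + n * l) * r ≤ B + A := by
    intro n
    obtain ⟨C, -, h⟩ := exists_goebel_kirk_inequality hl0 hl1 hrec hcontr n
    have hshift := hr.comp (Filter.tendsto_add_atTop_nat n)
    have hlim := ((hr.sub hshift).const_mul C).const_add (B + A)
    rw [sub_self, mul_zero, add_zero] at hlim
    refine le_of_tendsto_of_tendsto' (hr.const_mul (1 + n * l)) hlim fun i => (h i).trans ?_
    have h1 := norm_sub_le (w (i + n)) (z i)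
    have h2 := hB _ (Set.mem_range_self (i + n))
    have h3 := hA _ (Set.mem_range_self i)
    simp only [Function.comp_apply]
    linarith
  rcases hr0.eq_or_lt with h0 | hpos
  · rwa [← h0] at hr
  · obtain ⟨n, hn⟩ := exists_nat_gt ((B + A) / (l * r))
    rw [div_lt_iff₀ (mul_pos hl0 hpos)] at hn
    linarith [hbound n]
end

section
/- Let {x_n} be a bounded sequence in a Banach space X and let D be a nonempty closed convex subset of X. Then there exists a subsequence of {x_n} which is regular relative to D. -/
/-- The asymptotic radius of the sequence `x` relative to the set `E`:
`r(E, {x_n}) = inf { limsup_n ‖x_n - z‖ : z ∈ E }`. -/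
noncomputable def asymptoticRadius {X : Type*} [NormedAddCommGroup X]
    (E : Set X) (x : ℕ → X) : ℝ :=
  sInf ((fun z => Filter.limsup (fun n => ‖x n - z‖) Filter.atTop) '' E)

open Filter in
/-- A real functional on strictly increasing index sequences which is bounded below and monotone
with respect to passing to (eventual) subsequences is constant on the subsequences of some
sequence. -/
theorem exists_strictMono_forall_comp_eq (F : (ℕ → ℕ) → ℝ)
    (hF : BddBelow (F '' {φ | StrictMono φ}))
    (hmono : ∀ φ ψ : ℕ → ℕ, StrictMono φ → StrictMono ψ →
      map ψ atTop ≤ map φ atTop → F ψ ≤ F φ) :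
    ∃ φ : ℕ → ℕ, StrictMono φ ∧ ∀ ψ : ℕ → ℕ, StrictMono ψ → F (φ ∘ ψ) = F φ := by
  have step : ∀ (k : ℕ) (φ : {φ : ℕ → ℕ // StrictMono φ}),
      ∃ ψ : {φ : ℕ → ℕ // StrictMono φ}, map ψ.1 atTop ≤ map φ.1 atTop ∧
        ∀ χ : ℕ → ℕ, StrictMono χ → map χ atTop ≤ map φ.1 atTop →
          F ψ.1 ≤ F χ + 1 / ((k : ℝ) + 1) := by
    rintro k ⟨φ, hφ⟩
    let S : Set ℝ := F '' {χ | StrictMono χ ∧ map χ atTop ≤ map φ atTop}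
    have hSne : S.Nonempty := ⟨F φ, φ, ⟨hφ, le_rfl⟩, rfl⟩
    have hSb : BddBelow S := hF.mono (Set.image_mono fun χ hχ => hχ.1)
    obtain ⟨_, ⟨ψ, hψ, rfl⟩, hlt⟩ :=
      exists_lt_of_csInf_lt hSne (lt_add_of_pos_right (sInf S) (Nat.one_div_pos_of_nat (n := k)))
    refine ⟨⟨ψ, hψ.1⟩, hψ.2, fun χ hχ hle => hlt.le.trans ?_⟩
    gcongr
    exact csInf_le hSb ⟨χ, ⟨hχ, hle⟩, rfl⟩
  choose next hnext hmin using step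
  let Φ : ℕ → {φ : ℕ → ℕ // StrictMono φ} := fun k => Nat.rec ⟨id, strictMono_id⟩ next k
  let l : ℕ → Filter ℕ := fun k => map (Φ k).1 atTop
  have hl : Antitone l := antitone_nat_of_succ_le fun k => hnext k (Φ k)
  have : NeBot (⨅ k, l k) := iInf_neBot_of_directed hl.directed_ge fun k => inferInstance
  obtain ⟨d, hd⟩ := exists_seq_tendsto (⨅ k, l k)
  have hd_top : Tendsto d atTop atTop := hd.mono_right ((iInf_le l 0).trans map_id.le)
  obtain ⟨θ, hθ, hdθ⟩ := strictMono_subseq_of_tendsto_atTop hd_top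
  have hle (k : ℕ) : map (d ∘ θ) atTop ≤ l k :=
    (hd.comp hθ.tendsto_atTop).trans (iInf_le l k)
  refine ⟨d ∘ θ, hdθ, fun ψ hψ => ?_⟩
  have hsub : map ((d ∘ θ) ∘ ψ) atTop ≤ map (d ∘ θ) atTop := by
    rw [← map_map]
    exact map_mono hψ.tendsto_atTop
  refine le_antisymm (hmono _ _ hdθ (hdθ.comp hψ) hsub) ?_
  have hbound (k : ℕ) : F (d ∘ θ) ≤ F ((d ∘ θ) ∘ ψ) + 1 / ((k : ℝ) + 1) :=
    (hmono _ _ (Φ (k + 1)).2 hdθ (hle (k + 1))).trans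
      (hmin k (Φ k) _ (hdθ.comp hψ) (hsub.trans (hle k)))
  have hlim : Tendsto (fun k : ℕ => F ((d ∘ θ) ∘ ψ) + 1 / ((k : ℝ) + 1)) atTop
      (nhds (F ((d ∘ θ) ∘ ψ))) := by
    simpa using tendsto_one_div_add_atTop_nhds_zero_nat.const_add (F ((d ∘ θ) ∘ ψ))
  exact ge_of_tendsto' hlim hbound

/-- Goebel: Every bounded sequence in a Banach space has a subsequence
which is regular relative to a given nonempty closed convex subset `D`, i.e. every
further subsequence has the same asymptotic radius relative to `D`. -/
theorem exists_regular_subsequence {X : Type*} [NormedAddCommGroup X] [NormedSpace ℝ X]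
    [CompleteSpace X]
    (x : ℕ → X) (hx : Bornology.IsBounded (Set.range x))
    (D : Set X) (hne : D.Nonempty) (hcl : IsClosed D) (hconv : Convex ℝ D) :
    ∃ φ : ℕ → ℕ, StrictMono φ ∧
      ∀ ψ : ℕ → ℕ, StrictMono ψ →
        asymptoticRadius D (x ∘ φ ∘ ψ) = asymptoticRadius D (x ∘ φ) := by
  obtain ⟨C, hC⟩ := hx.exists_norm_le
  have hle (n : ℕ) (z : X) : ‖x n - z‖ ≤ C + ‖z‖ :=
    (norm_sub_le _ _).trans (by gcongr; exact hC _ ⟨n, rfl⟩)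
  have hbdd (l : Filter ℕ) (z : X) : l.IsBoundedUnder (· ≤ ·) fun n => ‖x n - z‖ :=
    Filter.isBoundedUnder_of ⟨C + ‖z‖, fun n => hle n z⟩
  have hcobdd (l : Filter ℕ) [l.NeBot] (z : X) :
      l.IsCoboundedUnder (· ≤ ·) fun n => ‖x n - z‖ :=
    (Filter.isBoundedUnder_of ⟨0, fun n => norm_nonneg _⟩ :
      l.IsBoundedUnder (· ≥ ·) fun n => ‖x n - z‖).isCoboundedUnder_le
  have hnonneg (φ : ℕ → ℕ) (z : X) :
      0 ≤ Filter.limsup (fun n => ‖x (φ n) - z‖) Filter.atTop :=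
    Filter.le_limsup_of_frequently_le (Filter.Frequently.of_forall fun n => norm_nonneg _)
      (Filter.isBoundedUnder_of ⟨C + ‖z‖, fun n => hle (φ n) z⟩)
  refine exists_strictMono_forall_comp_eq (fun φ => asymptoticRadius D (x ∘ φ)) ⟨0, ?_⟩ ?_
  · rintro _ ⟨φ, -, rfl⟩
    refine Real.sInf_nonneg ?_
    rintro _ ⟨z, -, rfl⟩
    exact hnonneg φ z
  · intro φ ψ _ _ h
    refine le_csInf (hne.image _) ?_
    rintro _ ⟨z, hz, rfl⟩
    refine (csInf_le ⟨0, ?_⟩ (Set.mem_image_of_mem _ hz)).trans ?_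
    · rintro _ ⟨w, -, rfl⟩
      exact hnonneg ψ w
    · exact Filter.limsup_le_limsup_of_le (u := fun n => ‖x n - z‖) h (hcobdd _ z) (hbdd _ z)
end

section
/- Let {x_n} be a bounded sequence in a Banach space X and let D be a nonempty closed convex separable subset of X. Then {x_n} contains a subsequence which is asymptotically uniform relative to D. -/
/-- The asymptotic center of the sequence `x` relative to the set `E`. -/
noncomputable def asymptoticCenter {X : Type*} [NormedAddCommGroup X]
    (E : Set X) (x : ℕ → X) : Set X :=
  {z ∈ E | Filter.limsup (fun n => ‖x n - z‖) Filter.atTop = asymptoticRadius E x}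

open Filter Topology

/-- If the distance functions along a sequence converge on a set, they converge on its closure. -/
lemma exists_tendsto_norm_sub_of_mem_closure {X : Type*} [NormedAddCommGroup X]
    {y : ℕ → X} {c : Set X} (h : ∀ s ∈ c, ∃ l, Tendsto (fun n => ‖y n - s‖) atTop (𝓝 l))
    {z : X} (hz : z ∈ closure c) : ∃ l, Tendsto (fun n => ‖y n - z‖) atTop (𝓝 l) := by
  refine cauchySeq_tendsto_of_complete (Metric.cauchySeq_iff'.2 fun ε hε => ?_)
  obtain ⟨s, hs, hzs⟩ := Metric.mem_closure_iff.1 hz (ε / 3) (by positivity)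
  obtain ⟨l, hl⟩ := h s hs
  obtain ⟨N, hN⟩ := Metric.cauchySeq_iff'.1 hl.cauchySeq (ε / 3) (by positivity)
  have key (n : ℕ) : |‖y n - z‖ - ‖y n - s‖| < ε / 3 := by
    refine (abs_norm_sub_norm_le _ _).trans_lt ?_
    rwa [sub_sub_sub_cancel_left, ← dist_eq_norm, dist_comm]
  refine ⟨N, fun n hn => ?_⟩
  have h₁ := hN n hn
  have h₂ := key n
  have h₃ := key N
  rw [Real.dist_eq] at h₁ ⊢
  rw [abs_lt] at *
  constructor <;> linarith

/-- A bounded sequence has a subsequence whose distances to each point of a given countable set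
converge. -/
lemma exists_subseq_tendsto_norm_sub {X : Type*} [NormedAddCommGroup X]
    {x : ℕ → X} (hx : Bornology.IsBounded (Set.range x)) {c : Set X} (hc : c.Countable) :
    ∃ φ : ℕ → ℕ, StrictMono φ ∧
      ∀ s ∈ c, ∃ l, Tendsto (fun n => ‖x (φ n) - s‖) atTop (𝓝 l) := by
  have := hc.to_subtype
  obtain ⟨M, hM⟩ := hx.exists_norm_le
  have hK : IsCompact (Set.univ.pi fun s : c => Set.Icc 0 (M + ‖(s : X)‖)) :=
    isCompact_univ_pi fun _ => isCompact_Icc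
  obtain ⟨a, -, φ, hφ, ha⟩ := hK.tendsto_subseq (x := fun n (s : c) => ‖x n - (s : X)‖) fun n s _ =>
    ⟨norm_nonneg _, (norm_sub_le _ _).trans (by gcongr; exact hM _ ⟨n, rfl⟩)⟩
  exact ⟨φ, hφ, fun s hs => ⟨a ⟨s, hs⟩, tendsto_pi_nhds.1 ha ⟨s, hs⟩⟩⟩

/-- The asymptotic center depends only on the upper limits of the distances to points of the set. -/
lemma asymptoticCenter_congr {X : Type*} [NormedAddCommGroup X] {E : Set X} {x y : ℕ → X}
    (h : ∀ z ∈ E, limsup (fun n => ‖x n - z‖) atTop = limsup (fun n => ‖y n - z‖) atTop) :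
    asymptoticCenter E x = asymptoticCenter E y := by
  have hr : asymptoticRadius E x = asymptoticRadius E y :=
    congrArg sInf (Set.image_congr h)
  ext z
  refine and_congr_right fun hz => ?_
  rw [h z hz, hr]

/-- Lim: Every bounded sequence in a Banach space has a subsequence
which is asymptotically uniform relative to a given nonempty closed convex separable
subset `D`, i.e. every further subsequence has the same asymptotic center relative
to `D`. -/
theorem exists_asymptotically_uniform_subsequence {X : Type*} [NormedAddCommGroup X]
    [NormedSpace ℝ X] [CompleteSpace X]
    (x : ℕ → X) (hx : Bornology.IsBounded (Set.range x))
    (D : Set X) (hne : D.Nonempty) (hcl : IsClosed D) (hconv : Convex ℝ D)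
    (hsep : TopologicalSpace.IsSeparable D) :
    ∃ φ : ℕ → ℕ, StrictMono φ ∧
      ∀ ψ : ℕ → ℕ, StrictMono ψ →
        asymptoticCenter D (x ∘ φ ∘ ψ) = asymptoticCenter D (x ∘ φ) := by
  obtain ⟨c, hc, hDc⟩ := hsep
  obtain ⟨φ, hφ, hlim⟩ := exists_subseq_tendsto_norm_sub hx hc
  refine ⟨φ, hφ, fun ψ hψ => asymptoticCenter_congr fun z hz => ?_⟩
  obtain ⟨l, hl⟩ := exists_tendsto_norm_sub_of_mem_closure (y := x ∘ φ) hlim (hDc hz)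
  exact (hl.comp hψ.tendsto_atTop).limsup_eq.trans hl.limsup_eq.symm
end

section
/- Let D be a nonempty closed convex bounded subset of a Banach space X and let t : D → D be a single-valued mapping satisfying conditions (E) and (C_λ) for some λ ∈ (0,1). Suppose that the asymptotic center relative to D of each (bounded) sequence in D is nonempty and compact. Then t has a fixed point. -/
open Filter Topology

/-- The Goebel–Kirk inequality for the Krasnoselskii iteration. -/
theorem goebel_kirk_inequality_s11 {X : Type*} [NormedAddCommGroup X] [NormedSpace ℝ X]
    {l : ℝ} (hl : l ∈ Set.Ioo (0:ℝ) 1) {x y : ℕ → X}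
    (hx : ∀ n, x (n + 1) = (1 - l) • x n + l • y n)
    (hy : ∀ n, ‖y (n + 1) - y n‖ ≤ l * ‖y n - x n‖)
    (hd : Antitone fun n => ‖y n - x n‖) (n i : ℕ) :
    (1 + n * l) * ‖y i - x i‖ ≤
      ‖y (i + n) - x i‖ + ((1 - l)⁻¹) ^ n * (‖y i - x i‖ - ‖y (i + n) - x (i + n)‖) := by
  obtain ⟨h0, h1⟩ := hl
  have hpos : 0 < 1 - l := by linarith
  induction n generalizing i with
  | zero => simp
  | succ n ih =>
    have htele : ∀ m : ℕ, ‖y (i + m) - y i‖ ≤ m * (l * ‖y i - x i‖) := by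
      intro m
      induction m with
      | zero => simp
      | succ m hm =>
        have h2 := norm_add_le (y (i + (m + 1)) - y (i + m)) (y (i + m) - y i)
        rw [sub_add_sub_cancel] at h2
        have h3 := hy (i + m)
        have h4 : l * ‖y (i + m) - x (i + m)‖ ≤ l * ‖y i - x i‖ :=
          mul_le_mul_of_nonneg_left (hd (Nat.le_add_right i m)) h0.le
        rw [add_assoc] at h3
        push_cast
        linarith
    have hconvex : ‖y (i + (n + 1)) - x (i + 1)‖ ≤
        (1 - l) * ‖y (i + (n + 1)) - x i‖ + l * ‖y (i + (n + 1)) - y i‖ := by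
      have : y (i + (n + 1)) - x (i + 1) =
          (1 - l) • (y (i + (n + 1)) - x i) + l • (y (i + (n + 1)) - y i) := by
        rw [hx]; module
      rw [this]
      refine (norm_add_le _ _).trans_eq ?_
      rw [norm_smul_of_nonneg hpos.le, norm_smul_of_nonneg h0.le]
    have hih := ih (i + 1)
    rw [show i + 1 + n = i + (n + 1) by ring] at hih
    have hbern : 1 + n * l ≤ ((1 - l)⁻¹) ^ n := by
      have hc : 1 + l ≤ (1 - l)⁻¹ := by
        rw [le_inv_comm₀ (by linarith) hpos, ← one_div, le_div_iff₀ (by linarith)]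
        nlinarith
      exact (one_add_mul_le_pow (by linarith) n).trans
        (pow_le_pow_left₀ (by linarith) hc n)
    have hmono : ‖y (i + 1) - x (i + 1)‖ ≤ ‖y i - x i‖ := hd (Nat.le_succ i)
    have htel := mul_le_mul_of_nonneg_left (htele (n + 1)) h0.le
    have hprod := mul_nonneg (sub_nonneg.2 hbern) (sub_nonneg.2 hmono)
    refine le_of_mul_le_mul_left ?_ hpos
    have hpow : (1 - l) * ((1 - l)⁻¹) ^ (n + 1) = ((1 - l)⁻¹) ^ n := by
      rw [pow_succ]; field_simp
    rw [mul_add, ← mul_assoc (1 - l) (((1 - l)⁻¹) ^ (n + 1)), hpow]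
    push_cast at htel ⊢
    linarith

/-- A self-map of a nonempty bounded convex set satisfying `(C_λ)` has almost fixed points. -/
theorem exists_norm_sub_map_lt {X : Type*} [NormedAddCommGroup X] [NormedSpace ℝ X]
    {D : Set X} (hne : D.Nonempty) (hconv : Convex ℝ D) (hbdd : Bornology.IsBounded D)
    {t : X → X} (ht : Set.MapsTo t D D) {l : ℝ} (hl : l ∈ Set.Ioo (0:ℝ) 1)
    (hC : ∀ x ∈ D, ∀ y ∈ D, l * ‖x - t x‖ ≤ ‖x - y‖ → ‖t x - t y‖ ≤ ‖x - y‖)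
    {ε : ℝ} (hε : 0 < ε) : ∃ x ∈ D, ‖x - t x‖ < ε := by
  obtain ⟨p, hp⟩ := hne
  have h0 := hl.1
  have hpos : 0 < 1 - l := sub_pos.2 hl.2
  let x : ℕ → X := fun n => (fun z => (1 - l) • z + l • t z)^[n] p
  have hx : ∀ n, x (n + 1) = (1 - l) • x n + l • t (x n) := fun n =>
    Function.iterate_succ_apply' _ n p
  have hxD : ∀ n, x n ∈ D := by
    intro n
    induction n with
    | zero => exact hp
    | succ n ih =>
      rw [hx]
      exact hconv ih (ht ih) hpos.le h0.le (by ring)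
  have hstep : ∀ n, ‖x n - x (n + 1)‖ = l * ‖t (x n) - x n‖ := by
    intro n
    rw [show x n - x (n + 1) = l • (x n - t (x n)) by rw [hx]; module,
      norm_smul_of_nonneg h0.le, norm_sub_rev]
  have hy : ∀ n, ‖t (x (n + 1)) - t (x n)‖ ≤ l * ‖t (x n) - x n‖ := by
    intro n
    rw [norm_sub_rev, ← hstep]
    refine hC _ (hxD n) _ (hxD (n + 1)) ?_
    rw [hstep, norm_sub_rev]
  have hd : Antitone fun n => ‖t (x n) - x n‖ := by
    refine antitone_nat_of_succ_le fun n => ?_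
    rw [show t (x (n + 1)) - x (n + 1) =
      (t (x (n + 1)) - t (x n)) + (1 - l) • (t (x n) - x n) by rw [hx]; module]
    refine (norm_add_le _ _).trans ?_
    rw [norm_smul_of_nonneg hpos.le]
    linarith [hy n]
  by_contra! hcon
  have hlow : ∀ n, ε ≤ ‖t (x n) - x n‖ := fun n => by
    rw [norm_sub_rev]; exact hcon _ (hxD n)
  obtain ⟨C, hCb⟩ := Metric.isBounded_iff.1 hbdd
  obtain ⟨n, hn⟩ := exists_nat_gt ((C + 1) / (l * ε))
  rw [div_lt_iff₀ (by positivity)] at hn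
  have hlim : Tendsto (fun i => ‖t (x i) - x i‖) atTop (𝓝 (⨅ i, ‖t (x i) - x i‖)) :=
    tendsto_atTop_ciInf hd ⟨0, by rintro _ ⟨i, rfl⟩; exact norm_nonneg _⟩
  have hdiff : Tendsto (fun i => ((1 - l)⁻¹) ^ n *
      (‖t (x i) - x i‖ - ‖t (x (i + n)) - x (i + n)‖)) atTop (𝓝 0) := by
    simpa using (hlim.sub (hlim.comp (tendsto_add_atTop_nat n))).const_mul (((1 - l)⁻¹) ^ n)
  obtain ⟨i, hi⟩ := (hdiff.eventually_lt_const one_pos).exists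
  have hgk := goebel_kirk_inequality_s11 hl hx hy hd n i
  have hdiam : ‖t (x (i + n)) - x i‖ ≤ C := by
    rw [← dist_eq_norm]; exact hCb (ht (hxD _)) (hxD _)
  have hmul : (1 + n * l) * ε ≤ (1 + n * l) * ‖t (x i) - x i‖ :=
    mul_le_mul_of_nonneg_left (hlow i) (by positivity)
  nlinarith

/-- A point of a bounded set `D` is in the asymptotic center of a sequence in `D` iff the
sequence eventually stays within any radius exceeding the asymptotic radius. -/
theorem mem_asymptoticCenter_iff {X : Type*} [NormedAddCommGroup X] {D : Set X}
    (hbdd : Bornology.IsBounded D) {x : ℕ → X} (hx : ∀ n, x n ∈ D) {z : X} :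
    z ∈ asymptoticCenter D x ↔
      z ∈ D ∧ ∀ ε > 0, ∀ᶠ n in atTop, ‖x n - z‖ ≤ asymptoticRadius D x + ε := by
  obtain ⟨C, hC⟩ := Metric.isBounded_iff.1 hbdd
  have hub : ∀ w ∈ D, IsBoundedUnder (· ≤ ·) atTop fun n => ‖x n - w‖ := fun w hw =>
    isBoundedUnder_of ⟨C, fun n => by rw [← dist_eq_norm]; exact hC (hx n) hw⟩
  have hlb : ∀ w : X, IsBoundedUnder (· ≥ ·) atTop fun n => ‖x n - w‖ := fun w =>
    isBoundedUnder_of ⟨0, fun n => norm_nonneg _⟩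
  constructor
  · rintro ⟨hz, hr⟩
    refine ⟨hz, fun ε hε => ?_⟩
    have hlt : limsup (fun n => ‖x n - z‖) atTop < asymptoticRadius D x + ε := by linarith
    exact (eventually_lt_of_limsup_lt hlt (hub z hz)).mono fun _ => le_of_lt
  · rintro ⟨hz, hr⟩
    refine ⟨hz, le_antisymm ?_ ?_⟩
    · exact le_of_forall_pos_le_add fun ε hε =>
        limsup_le_of_le (hlb z).isCoboundedUnder_le (hr ε hε)
    · refine csInf_le ⟨0, ?_⟩ ⟨z, hz, rfl⟩
      rintro _ ⟨w, hw, rfl⟩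
      exact le_limsup_of_frequently_le (Frequently.of_forall fun n => norm_nonneg _) (hub w hw)

/-- The asymptotic center relative to a bounded convex set is convex. -/
theorem convex_asymptoticCenter {X : Type*} [NormedAddCommGroup X] [NormedSpace ℝ X]
    {D : Set X} (hconv : Convex ℝ D) (hbdd : Bornology.IsBounded D) {x : ℕ → X}
    (hx : ∀ n, x n ∈ D) : Convex ℝ (asymptoticCenter D x) := by
  intro z hz w hw a b ha hb hab
  rw [mem_asymptoticCenter_iff hbdd hx] at hz hw ⊢
  refine ⟨hconv hz.1 hw.1 ha hb hab, fun ε hε => ?_⟩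
  filter_upwards [hz.2 ε hε, hw.2 ε hε] with n hnz hnw
  have := convex_closedBall (x n) (asymptoticRadius D x + ε)
    (by rwa [mem_closedBall_iff_norm'] : z ∈ _) (by rwa [mem_closedBall_iff_norm'] : w ∈ _)
    ha hb hab
  rwa [mem_closedBall_iff_norm'] at this

/-- A map satisfying condition (E) preserves the asymptotic center of an approximate fixed point
sequence. -/
theorem mapsTo_asymptoticCenter {X : Type*} [NormedAddCommGroup X]
    {D : Set X} (hbdd : Bornology.IsBounded D) {t : X → X} (ht : Set.MapsTo t D D) {μ : ℝ}
    (hE : ∀ x ∈ D, ∀ y ∈ D, ‖x - t y‖ ≤ μ * ‖x - t x‖ + ‖x - y‖)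
    {x : ℕ → X} (hx : ∀ n, x n ∈ D) (hlim : Tendsto (fun n => ‖x n - t (x n)‖) atTop (𝓝 0)) :
    Set.MapsTo t (asymptoticCenter D x) (asymptoticCenter D x) := by
  intro z hz
  rw [mem_asymptoticCenter_iff hbdd hx] at hz ⊢
  refine ⟨ht hz.1, fun ε hε => ?_⟩
  have hμ : Tendsto (fun n => μ * ‖x n - t (x n)‖) atTop (𝓝 0) := by
    simpa using hlim.const_mul μ
  filter_upwards [hz.2 (ε / 2) (half_pos hε), hμ.eventually_lt_const (half_pos hε)] with n h1 h2
  linarith [hE _ (hx n) z hz.1]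

/-- A self-map of a nonempty bounded convex set satisfying `(C_λ)` has an approximate fixed point
sequence. -/
theorem exists_seq_tendsto_norm_sub_map {X : Type*} [NormedAddCommGroup X] [NormedSpace ℝ X]
    {D : Set X} (hne : D.Nonempty) (hconv : Convex ℝ D) (hbdd : Bornology.IsBounded D)
    {t : X → X} (ht : Set.MapsTo t D D) {l : ℝ} (hl : l ∈ Set.Ioo (0:ℝ) 1)
    (hC : ∀ x ∈ D, ∀ y ∈ D, l * ‖x - t x‖ ≤ ‖x - y‖ → ‖t x - t y‖ ≤ ‖x - y‖) :
    ∃ x : ℕ → X, (∀ n, x n ∈ D) ∧ Tendsto (fun n => ‖x n - t (x n)‖) atTop (𝓝 0) := by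
  choose x hxD hx using fun n : ℕ =>
    exists_norm_sub_map_lt hne hconv hbdd ht hl hC (Nat.one_div_pos_of_nat (α := ℝ) (n := n))
  exact ⟨x, hxD, squeeze_zero (fun _ => norm_nonneg _) (fun n => (hx n).le)
    tendsto_one_div_add_atTop_nhds_zero_nat⟩


/-- Theorem 3.3: Let `D` be a nonempty closed convex bounded subset of a
Banach space and `t : D → D` satisfy conditions (E) and `(C_λ)` for some `λ ∈ (0,1)`.
If the asymptotic center relative to `D` of each sequence in `D` is nonempty and
compact, then `t` has a fixed point. -/
theorem singlevalued_fixed_point {X : Type*} [NormedAddCommGroup X] [NormedSpace ℝ X]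
    [CompleteSpace X]
    (D : Set X) (hne : D.Nonempty) (hcl : IsClosed D) (hconv : Convex ℝ D)
    (hbdd : Bornology.IsBounded D)
    (t : X → X) (ht : Set.MapsTo t D D)
    (l : ℝ) (hl : l ∈ Set.Ioo (0:ℝ) 1)
    (hC : ∀ x ∈ D, ∀ y ∈ D, l * ‖x - t x‖ ≤ ‖x - y‖ → ‖t x - t y‖ ≤ ‖x - y‖)
    (hE : ∃ μ : ℝ, 1 ≤ μ ∧ ∀ x ∈ D, ∀ y ∈ D, ‖x - t y‖ ≤ μ * ‖x - t x‖ + ‖x - y‖)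
    (hAC : ∀ x : ℕ → X, (∀ n, x n ∈ D) →
      (asymptoticCenter D x).Nonempty ∧ IsCompact (asymptoticCenter D x)) :
    ∃ z ∈ D, t z = z := by
  obtain ⟨μ, -, hE⟩ := hE
  obtain ⟨x, hxD, hx⟩ := exists_seq_tendsto_norm_sub_map hne hconv hbdd ht hl hC
  obtain ⟨hAne, hAcpt⟩ := hAC x hxD
  have hAD : asymptoticCenter D x ⊆ D := fun z hz => hz.1
  obtain ⟨z, hzA, hz⟩ := exists_seq_tendsto_norm_sub_map hAne
    (convex_asymptoticCenter hconv hbdd hxD) hAcpt.isBounded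
    (mapsTo_asymptoticCenter hbdd ht hE hxD hx) hl
    fun u hu v hv => hC u (hAD hu) v (hAD hv)
  obtain ⟨w, hwA, φ, hφ, hw⟩ := hAcpt.tendsto_subseq hzA
  refine ⟨w, hAD hwA, tendsto_nhds_unique ?_ hw⟩
  rw [tendsto_iff_norm_sub_tendsto_zero] at hw ⊢
  refine squeeze_zero (fun _ => norm_nonneg _)
    (fun n => hE _ (hAD (hzA (φ n))) w (hAD hwA)) ?_
  simpa using ((hz.comp hφ.tendsto_atTop).const_mul μ).add hw
end

section
/- Let D be a nonempty closed convex bounded subset of a uniformly convex Banach space X, let t : D → D be a nonexpansive single-valued mapping and T : D → KC(D) a nonexpansive multivalued mapping, and suppose t and T commute. Then there exists a point z ∈ D such that z = t(z) ∈ T(z). -/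
open Filter Topology

section Auxiliary

variable {X : Type*} [NormedAddCommGroup X] [NormedSpace ℝ X]

/-- Uniform convexity at all radii slightly larger than `R`. -/
lemma UniformConvexSpace.exists_norm_add_le_of_norm_le [UniformConvexSpace X]
    {R ε : ℝ} (hR : 0 ≤ R) (hε : 0 < ε) :
    ∃ ρ > R, ∃ R' < R, ∀ a b : X, ‖a‖ ≤ ρ → ‖b‖ ≤ ρ → ε ≤ ‖a - b‖ → ‖a + b‖ ≤ 2 * R' := by
  rcases hR.eq_or_lt with rfl | hR
  · refine ⟨ε / 4, by linarith, -1, by norm_num, fun a b ha hb hab => ?_⟩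
    linarith [norm_sub_le a b]
  obtain ⟨δ, hδ, h⟩ := exists_forall_closed_ball_dist_add_le_two_sub X
    (show 0 < ε / (2 * R) by positivity)
  set c := min δ 1 with hc
  have hc0 : 0 < c := lt_min hδ one_pos
  have hc1 : c ≤ 1 := min_le_right _ _
  have hcδ : c ≤ δ := min_le_left _ _
  refine ⟨R * (1 + c / 4), by nlinarith, R * (1 + c / 4) * (1 - c / 2), ?_, ?_⟩
  · nlinarith [mul_pos hR hc0, mul_pos (mul_pos hR hc0) hc0]
  intro a b ha hb hab
  set ρ := R * (1 + c / 4) with hρ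
  have hρ0 : 0 < ρ := by positivity
  have hρ2 : ρ ≤ 2 * R := by nlinarith
  have hscale (v : X) : ‖ρ⁻¹ • v‖ = ‖v‖ / ρ := by
    rw [norm_smul, norm_inv, Real.norm_of_nonneg hρ0.le]; field_simp
  have key := @h (ρ⁻¹ • a) (by rw [hscale]; exact (div_le_one hρ0).2 ha) (ρ⁻¹ • b)
    (by rw [hscale]; exact (div_le_one hρ0).2 hb)
    (by rw [← smul_sub, hscale]; gcongr)
  rw [← smul_add, hscale, div_le_iff₀ hρ0] at key
  nlinarith

/-- Every bounded sequence has, along any ultrafilter, a unique asymptotic center in a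
closed convex set. -/
lemma exists_unique_asymptotic_center [CompleteSpace X] [UniformConvexSpace X]
    {F : Set X} (hne : F.Nonempty) (hcl : IsClosed F) (hconv : Convex ℝ F)
    {ι : Type*} (U : Ultrafilter ι) (x : ι → X) (r : X → ℝ)
    (hr : ∀ y, Tendsto (fun n => ‖x n - y‖) U (𝓝 (r y))) :
    ∃ z ∈ F, ∀ u ∈ F, r u ≤ r z → u = z := by
  have hr0 (y : X) : 0 ≤ r y := ge_of_tendsto' (hr y) fun n => norm_nonneg _
  have hlip (y y' : X) : r y ≤ r y' + ‖y' - y‖ := by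
    refine le_of_tendsto_of_tendsto' (hr y) ((hr y').add_const _) fun n => ?_
    simpa using norm_add_le (x n - y') (y' - y)
  set R := sInf (r '' F) with hRdef
  have hbdd : BddBelow (r '' F) := ⟨0, by rintro _ ⟨y, -, rfl⟩; exact hr0 y⟩
  have hR (y : X) (hy : y ∈ F) : R ≤ r y := csInf_le hbdd ⟨y, hy, rfl⟩
  have hR0 : 0 ≤ R := le_csInf (hne.image r) (by rintro _ ⟨y, -, rfl⟩; exact hr0 y)
  have hclose (ε : ℝ) (hε : 0 < ε) :
      ∃ ρ > R, ∀ y ∈ F, ∀ y' ∈ F, r y < ρ → r y' < ρ → ‖y - y'‖ < ε := by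
    obtain ⟨ρ, hρ, R', hR', h⟩ :=
      UniformConvexSpace.exists_norm_add_le_of_norm_le (X := X) hR0 hε
    refine ⟨ρ, hρ, fun y hy y' hy' hyρ hyρ' => ?_⟩
    by_contra! hlt
    have hm : (1 / 2 : ℝ) • y + (1 / 2 : ℝ) • y' ∈ F :=
      hconv hy hy' (by norm_num) (by norm_num) (by norm_num)
    refine (hR _ hm).not_gt (lt_of_le_of_lt (le_of_tendsto (hr _) ?_) hR')
    filter_upwards [(hr y).eventually_lt_const hyρ, (hr y').eventually_lt_const hyρ']
      with n h1 h2
    have h3 := h (x n - y) (x n - y') h1.le h2.le (by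
      rw [norm_sub_rev] at hlt; simpa using hlt)
    have h4 : x n - ((1 / 2 : ℝ) • y + (1 / 2 : ℝ) • y') =
        (1 / 2 : ℝ) • ((x n - y) + (x n - y')) := by module
    rw [h4, norm_smul, Real.norm_of_nonneg (by norm_num)]
    linarith
  have hex (n : ℕ) : ∃ y ∈ F, r y < R + 1 / ((n : ℝ) + 1) := by
    obtain ⟨_, ⟨y, hy, rfl⟩, h⟩ := exists_lt_of_csInf_lt (hne.image r)
      (show sInf (r '' F) < R + 1 / ((n : ℝ) + 1) from lt_add_of_pos_right _ (by positivity))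
    exact ⟨y, hy, h⟩
  choose y hyF hy using hex
  have hlim : Tendsto (fun n : ℕ => R + 1 / ((n : ℝ) + 1)) atTop (𝓝 R) := by
    simpa using tendsto_one_div_add_atTop_nhds_zero_nat.const_add R
  have hcau : CauchySeq y := by
    refine Metric.cauchySeq_iff.2 fun ε hε => ?_
    obtain ⟨ρ, hρ, h⟩ := hclose ε hε
    obtain ⟨N, hN⟩ := eventually_atTop.1 (hlim.eventually_lt_const hρ)
    refine ⟨N, fun m hm n hn => ?_⟩
    rw [dist_eq_norm]
    exact h _ (hyF m) _ (hyF n) ((hy m).trans (hN m hm)) ((hy n).trans (hN n hn))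
  obtain ⟨z, hz⟩ := cauchySeq_tendsto_of_complete hcau
  have hzF : z ∈ F := hcl.mem_of_tendsto hz (Eventually.of_forall hyF)
  have hzR : r z ≤ R := by
    refine ge_of_tendsto' (b := r z)
      (f := fun n : ℕ => R + 1 / ((n : ℝ) + 1) + ‖y n - z‖) (x := atTop) ?_
      fun n => (hlip z (y n)).trans (by linarith [hy n])
    simpa using hlim.add (tendsto_iff_norm_sub_tendsto_zero.1 hz)
  refine ⟨z, hzF, fun u hu hur => ?_⟩
  rw [← sub_eq_zero, ← norm_le_zero_iff]
  refine le_of_forall_pos_lt_add fun ε hε => ?_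
  obtain ⟨ρ, hρ, h⟩ := hclose ε hε
  simpa using h u hu z hzF (by linarith) (by linarith)

/-- A multivalued nonexpansive mapping of a bounded convex set has approximate fixed points. -/
lemma exists_approximate_fixed_point {F : Set X} (hne : F.Nonempty) (hconv : Convex ℝ F)
    (hbdd : Bornology.IsBounded F) (S : X → Set X)
    (hSne : ∀ x ∈ F, (S x).Nonempty) (hSF : ∀ x ∈ F, S x ⊆ F)
    (hS : ∀ x ∈ F, ∀ y ∈ F, ∀ u ∈ S x, ∃ v ∈ S y, ‖u - v‖ ≤ ‖x - y‖)
    {ε : ℝ} (hε : 0 < ε) : ∃ x ∈ F, ∃ y ∈ S x, ‖x - y‖ < ε := by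
  obtain ⟨p, hp⟩ := hne
  obtain ⟨M, hM0, hM⟩ : ∃ M > 0, ∀ a ∈ F, ∀ b ∈ F, ‖a - b‖ ≤ M := by
    obtain ⟨C, hC⟩ := Metric.isBounded_iff.1 hbdd
    refine ⟨max C 1, by positivity, fun a ha b hb => ?_⟩
    rw [← dist_eq_norm]
    exact (hC ha hb).trans (le_max_left _ _)
  obtain ⟨s, hs0, hs1, hsM⟩ : ∃ s : ℝ, 0 < s ∧ s < 1 ∧ s * M < ε / 2 := by
    refine ⟨min (1 / 2) (ε / (4 * M)), by positivity,
      (min_le_left _ _).trans_lt (by norm_num), ?_⟩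
    calc min (1 / 2) (ε / (4 * M)) * M ≤ ε / (4 * M) * M := by gcongr; exact min_le_right _ _
      _ = ε / 4 := by field_simp
      _ < ε / 2 := by linarith
  have hmem (y : X) (hy : y ∈ F) : (1 - s) • y + s • p ∈ F :=
    hconv hy hp (by linarith) hs0.le (by ring)
  have hiter (n : ℕ) : ∃ x ∈ F, ∃ y ∈ S x, ‖x - ((1 - s) • y + s • p)‖ ≤ (1 - s) ^ n * M := by
    induction n with
    | zero =>
      obtain ⟨y, hy⟩ := hSne p hp
      exact ⟨p, hp, y, hy, by simpa using hM p hp _ (hmem y (hSF p hp hy))⟩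
    | succ n ih =>
      obtain ⟨x, hx, y, hy, h⟩ := ih
      have hx' := hmem y (hSF x hx hy)
      obtain ⟨y', hy', h'⟩ := hS x hx _ hx' y hy
      refine ⟨_, hx', y', hy', ?_⟩
      rw [add_sub_add_right_eq_sub, ← smul_sub, norm_smul, Real.norm_of_nonneg (by linarith),
        pow_succ', mul_assoc]
      exact mul_le_mul_of_nonneg_left (h'.trans h) (by linarith)
  obtain ⟨n, hn⟩ := exists_pow_lt_of_lt_one (show 0 < ε / (2 * M) by positivity)
    (show 1 - s < 1 by linarith)
  obtain ⟨x, hx, y, hy, h⟩ := hiter n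
  refine ⟨x, hx, y, hy, ?_⟩
  have h1 : (1 - s) ^ n * M < ε / 2 := by
    calc (1 - s) ^ n * M < ε / (2 * M) * M := by gcongr
      _ = ε / 2 := by field_simp
  have h2 : x - y = (x - ((1 - s) • y + s • p)) + s • (p - y) := by module
  have h3 : ‖s • (p - y)‖ ≤ s * M := by
    rw [norm_smul, Real.norm_of_nonneg hs0.le]
    exact mul_le_mul_of_nonneg_left (hM p hp y (hSF x hx hy)) hs0.le
  rw [h2]
  linarith [norm_add_le (x - ((1 - s) • y + s • p)) (s • (p - y))]

/-- **Lim's theorem**: a compact-valued nonexpansive mapping of a bounded closed convex subset of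
a uniformly convex Banach space has a fixed point. -/
theorem exists_mem_of_multivalued_nonexpansive [CompleteSpace X] [UniformConvexSpace X]
    {F : Set X} (hne : F.Nonempty) (hcl : IsClosed F) (hconv : Convex ℝ F)
    (hbdd : Bornology.IsBounded F) (S : X → Set X)
    (hSne : ∀ x ∈ F, (S x).Nonempty) (hSF : ∀ x ∈ F, S x ⊆ F)
    (hScp : ∀ x ∈ F, IsCompact (S x))
    (hS : ∀ x ∈ F, ∀ y ∈ F, ∀ u ∈ S x, ∃ v ∈ S y, ‖u - v‖ ≤ ‖x - y‖) :
    ∃ z ∈ F, z ∈ S z := by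
  have happrox (n : ℕ) : ∃ x ∈ F, ∃ y ∈ S x, ‖x - y‖ < 1 / ((n : ℝ) + 1) :=
    exists_approximate_fixed_point hne hconv hbdd S hSne hSF hS (by positivity)
  choose x hxF y hyS hxy using happrox
  let U : Ultrafilter ℕ := Ultrafilter.of atTop
  have hU : (U : Filter ℕ) ≤ atTop := Ultrafilter.of_le _
  have hr (w : X) : ∃ c, Tendsto (fun n => ‖x n - w‖) U (𝓝 c) := by
    obtain ⟨C, hC⟩ := hbdd.exists_norm_le
    obtain ⟨c, -, hc⟩ := (isCompact_Icc (a := (0 : ℝ)) (b := C + ‖w‖)).ultrafilter_le_nhds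
      (U.map fun n => ‖x n - w‖) (tendsto_principal.2 (Eventually.of_forall fun n =>
        ⟨norm_nonneg _, (norm_sub_le _ _).trans (by linarith [hC _ (hxF n)])⟩))
    exact ⟨c, hc⟩
  choose r hr using hr
  obtain ⟨z, hzF, hz⟩ := exists_unique_asymptotic_center hne hcl hconv U x r hr
  choose v hvS hv using fun n => hS (x n) (hxF n) z hzF (y n) (hyS n)
  obtain ⟨u, huS, hu⟩ := (hScp z hzF).ultrafilter_le_nhds (U.map v)
    (tendsto_principal.2 (Eventually.of_forall hvS))
  have hu' : Tendsto v U (𝓝 u) := hu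
  have h0 : Tendsto (fun n : ℕ => 1 / ((n : ℝ) + 1)) U (𝓝 0) :=
    tendsto_one_div_add_atTop_nhds_zero_nat.mono_left hU
  have hru : r u ≤ r z := by
    refine le_of_tendsto_of_tendsto' (hr u)
      (g := fun n : ℕ => 1 / ((n : ℝ) + 1) + ‖x n - z‖ + ‖v n - u‖) ?_ fun n => ?_
    · simpa using (h0.add (hr z)).add (tendsto_iff_norm_sub_tendsto_zero.1 hu')
    · have h1 : x n - u = (x n - y n) + (y n - v n) + (v n - u) := by abel
      rw [h1]
      exact norm_add₃_le.trans (by linarith [hxy n, hv n])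
  exact ⟨z, hzF, hz u (hSF z hzF huS) hru ▸ huS⟩

/-- Nearest points in a convex subset of a strictly convex space are unique. -/
lemma Convex.eq_of_norm_sub_eq_infDist [StrictConvexSpace ℝ X] {K : Set X} (hK : Convex ℝ K)
    {w p q : X} (hp : p ∈ K) (hq : q ∈ K) (hpd : ‖w - p‖ = Metric.infDist w K)
    (hqd : ‖w - q‖ = Metric.infDist w K) : p = q := by
  by_contra hpq
  have h := (norm_midpoint_lt_iff (hpd.trans hqd.symm)).2 fun h => hpq (sub_right_injective h)
  have hm : (1 / 2 : ℝ) • p + (1 / 2 : ℝ) • q ∈ K :=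
    hK hp hq (by norm_num) (by norm_num) (by norm_num)
  have h1 := Metric.infDist_le_dist_of_mem (x := w) hm
  have h2 : w - ((1 / 2 : ℝ) • p + (1 / 2 : ℝ) • q) =
      (1 / 2 : ℝ) • ((w - p) + (w - q)) := by module
  rw [dist_eq_norm, h2] at h1
  linarith

/-- The fixed point set of a nonexpansive mapping of a convex set is convex. -/
lemma convex_fixedPoints_of_nonexpansive [StrictConvexSpace ℝ X] {D : Set X}
    (hconv : Convex ℝ D) {t : X → X}
    (htnonexp : ∀ x ∈ D, ∀ y ∈ D, ‖t x - t y‖ ≤ ‖x - y‖) :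
    Convex ℝ {x ∈ D | t x = x} := by
  rintro x ⟨hx, htx⟩ y ⟨hy, hty⟩ a b ha hb hab
  have hm := hconv hx hy ha hb hab
  refine ⟨hm, ?_⟩
  set m := a • x + b • y with hmdef
  obtain rfl : a = 1 - b := by linarith
  have h1 : dist x (t m) ≤ b * dist x y := by
    have := htnonexp x hx m hm
    rw [htx, show x - m = b • (x - y) by rw [hmdef]; module, norm_smul,
      Real.norm_of_nonneg hb] at this
    simpa [dist_eq_norm] using this
  have h2 : dist (t m) y ≤ (1 - b) * dist x y := by
    have := htnonexp m hm y hy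
    rw [hty, show m - y = (1 - b) • (x - y) by rw [hmdef]; module, norm_smul,
      Real.norm_of_nonneg ha] at this
    simpa [dist_eq_norm] using this
  have h3 := dist_triangle x (t m) y
  rw [eq_lineMap_of_dist_eq_mul_of_dist_eq_mul (x := x) (y := t m) (z := y) (r := b)
    (by linarith) (by linarith), AffineMap.lineMap_apply_module]

end Auxiliary


/-- Corollary 3.10: Let `D` be a nonempty closed convex bounded subset
of a uniformly convex Banach space, `t : D → D` a nonexpansive single-valued mapping
and `T : D → KC(D)` a nonexpansive multivalued mapping, which commute. Then there
exists `z ∈ D` with `z = t(z) ∈ T(z)`. -/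
theorem common_fixed_point_nonexpansive_uniformly_convex {X : Type*}
    [NormedAddCommGroup X] [NormedSpace ℝ X] [CompleteSpace X] [UniformConvexSpace X]
    (D : Set X) (hne : D.Nonempty) (hcl : IsClosed D) (hconv : Convex ℝ D)
    (hbdd : Bornology.IsBounded D)
    (t : X → X) (ht : Set.MapsTo t D D)
    (htnonexp : ∀ x ∈ D, ∀ y ∈ D, ‖t x - t y‖ ≤ ‖x - y‖)
    (T : X → Set X)
    (hTne : ∀ x ∈ D, (T x).Nonempty) (hTcp : ∀ x ∈ D, IsCompact (T x))
    (hTconv : ∀ x ∈ D, Convex ℝ (T x)) (hTsub : ∀ x ∈ D, T x ⊆ D)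
    (hTnonexp : ∀ x ∈ D, ∀ y ∈ D, Metric.hausdorffDist (T x) (T y) ≤ ‖x - y‖)
    (hcomm : ∀ x ∈ D, ∀ y ∈ D, x ∈ T y → t y ∈ D → t x ∈ T (t y)) :
    ∃ z ∈ D, t z = z ∧ z ∈ T z := by
  have htcont : ContinuousOn t D :=
    (LipschitzOnWith.of_dist_le_mul (K := 1) fun x hx y hy => by
      simpa [dist_eq_norm] using htnonexp x hx y hy).continuousOn
  set F : Set X := {x ∈ D | t x = x} with hFdef
  have hFne : F.Nonempty := by
    obtain ⟨z, hz, hzt⟩ := exists_mem_of_multivalued_nonexpansive hne hcl hconv hbdd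
      (fun x => {t x}) (fun x _ => Set.singleton_nonempty _)
      (fun x hx => Set.singleton_subset_iff.2 (ht hx)) (fun x _ => isCompact_singleton)
      (by simpa using htnonexp)
    exact ⟨z, hz, (Set.mem_singleton_iff.1 hzt).symm⟩
  have hFcl : IsClosed F := by
    have h := (htcont.sub continuousOn_id).preimage_isClosed_of_isClosed hcl
      (isClosed_singleton (x := (0 : X)))
    convert h using 1
    ext x
    simp [hFdef, sub_eq_zero]
  have hnear (u : X) (hu : u ∈ F) (y : X) (hy : y ∈ F) :
      ∃ v ∈ T y ∩ F, ‖u - v‖ = Metric.infDist u (T y) := by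
    obtain ⟨p, hp, hpd⟩ := (hTcp y hy.1).exists_infDist_eq_dist (hTne y hy.1) u
    rw [dist_eq_norm] at hpd
    have hpD := hTsub y hy.1 hp
    have htp : t p ∈ T y := by
      simpa [hy.2] using hcomm p hpD y hy.1 hp (ht hy.1)
    have hle : ‖u - t p‖ ≤ ‖u - p‖ := by simpa [hu.2] using htnonexp u hu.1 p hpD
    have hge : Metric.infDist u (T y) ≤ ‖u - t p‖ := by
      simpa [dist_eq_norm] using Metric.infDist_le_dist_of_mem (x := u) htp
    exact ⟨p, ⟨hp, hpD, (hTconv y hy.1).eq_of_norm_sub_eq_infDist htp hp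
      (by linarith) hpd.symm⟩, hpd.symm⟩
  obtain ⟨z, hzF, hz⟩ := exists_mem_of_multivalued_nonexpansive hFne hFcl
    (convex_fixedPoints_of_nonexpansive hconv htnonexp) (hbdd.subset fun x hx => hx.1)
    (fun x => T x ∩ F)
    (fun x hx => let ⟨v, hv, _⟩ := hnear x hx x hx; ⟨v, hv⟩) (fun x _ => Set.inter_subset_right)
    (fun x hx => (hTcp x hx.1).inter_right hFcl)
    (fun x hx y hy u hu => by
      obtain ⟨v, hv, h⟩ := hnear u hu.2 y hy
      refine ⟨v, hv, h.le.trans (le_trans ?_ (hTnonexp x hx.1 y hy.1))⟩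
      exact Metric.infDist_le_hausdorffDist_of_mem hu.1
        (Metric.hausdorffEDist_ne_top_of_nonempty_of_bounded (hTne x hx.1) (hTne y hy.1)
          (hTcp x hx.1).isBounded (hTcp y hy.1).isBounded))
  exact ⟨z, hzF.1, hzF.2, hz.1⟩
end
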